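/- arXiv:2401.02602 — 3 statements merged into one kernel-verified Lean document; each statement's English description precedes it below -/
import Mathlib

section
/- Let M and M' be two finite recursive SCMs over the same endogenous variables V, the same domains D, and the same parent sets Pa. Then P^M(F = f) = P^{M'}(F = f) for every tuple f — where {F = f} denotes the joint counterfactual event that for every variable i and every parent value pa, the potential response of i under the intervention fixing Pa(i) to pa equals f_{(i,pa)} — if and only if L3(M) = L3(M'), i.e., M and M' assign equal probability to every counterfactual query. -/
set_option linter.unusedVariables false

open Classical

universe u

/-- A finite recursive structural causal model over endogenous variables `Fin n`
with finite domains `D i`. `Pa i ⊆ {0, …, i-1}` are the endogenous parents of `i`,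
`U` is the finite exogenous sample space with probability mass function `P`, and
`mech i` is the mechanism of variable `i`. -/
structure SCM (n : ℕ) (D : Fin n → Type u) where
  U : Type u
  fintypeU : Fintype U
  P : U → ℝ
  P_nonneg : ∀ u, 0 ≤ P u
  P_sum : (@Finset.univ U fintypeU).sum P = 1
  Pa : Fin n → Finset (Fin n)
  Pa_lt : ∀ i : Fin n, ∀ j ∈ Pa i, j < i
  mech : ∀ i : Fin n, (∀ j ∈ Pa i, D j) → U → D i

attribute [instance] SCM.fintypeU

namespace SCM

variable {n : ℕ} {D : Fin n → Type u}

/-- The potential response `V_[x](u)`: the value of each endogenous variable under the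
intervention fixing the variables of `X` to `x`, with exogenous value `u`. -/
noncomputable def resp (M : SCM n D) (X : Finset (Fin n)) (x : ∀ i ∈ X, D i)
    (u : M.U) : (i : Fin n) → D i
  | i =>
    if h : i ∈ X then x i h
    else M.mech i (fun j hj => M.resp X x u j) u
termination_by i => i.1
decreasing_by exact M.Pa_lt i j hj

end SCM

/-- A counterfactual query: `k` terms, the `j`-th asking that the variables of `Y j`
take the values `y j` under the intervention fixing `X j` to `x j`. -/
structure CtfQuery (n : ℕ) (D : Fin n → Type u) where
  k : ℕ
  Y : Fin k → Finset (Fin n)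
  X : Fin k → Finset (Fin n)
  x : ∀ j : Fin k, ∀ i ∈ X j, D i
  y : ∀ j : Fin k, ∀ i ∈ Y j, D i

/-- The counterfactual probability `P^M(Y¹_[x¹]=y¹, …, Y^k_[x^k]=y^k)`. -/
noncomputable def SCM.ctfProb {n : ℕ} {D : Fin n → Type u} (M : SCM n D)
    (q : CtfQuery n D) : ℝ :=
  ∑ u : M.U,
    if ∀ (j : Fin q.k) (i : Fin n) (h : i ∈ q.Y j),
        M.resp (q.X j) (q.x j) u i = q.y j i h
    then M.P u else 0

/-- `L3(M) = L3(M')`: the two SCMs (over the same variables and domains) assign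
equal probability to every counterfactual query. -/
def L3eq {n : ℕ} {D : Fin n → Type u} (M M' : SCM n D) : Prop :=
  ∀ q : CtfQuery n D, M.ctfProb q = M'.ctfProb q

/-- The probability under `M` of the joint functional-counterfactual event `F = f`:
for every variable `i` and every parent value `pa`, the potential response of `i`
under the intervention fixing `Pa i` to `pa` equals `f i pa`. -/
noncomputable def SCM.fctfProb {n : ℕ} {D : Fin n → Type u} (M : SCM n D)
    (f : ∀ i : Fin n, (∀ j ∈ M.Pa i, D j) → D i) : ℝ :=
  ∑ u : M.U,
    if ∀ (i : Fin n) (pa : ∀ j ∈ M.Pa i, D j), M.resp (M.Pa i) pa u i = f i pa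
    then M.P u else 0

namespace SCM

variable {n : ℕ} {D : Fin n → Type u}

/-- The solution of the recursive system with parent sets `Pa` and deterministic mechanisms `f`
under the intervention fixing the variables of `X` to `x`. -/
noncomputable def solve (Pa : Fin n → Finset (Fin n)) (hlt : ∀ i, ∀ j ∈ Pa i, j < i)
    (f : ∀ i, (∀ j ∈ Pa i, D j) → D i) (X : Finset (Fin n)) (x : ∀ i ∈ X, D i) :
    (i : Fin n) → D i
  | i =>
    if h : i ∈ X then x i h
    else f i (fun j hj => solve Pa hlt f X x j)
termination_by i => i.1
decreasing_by exact hlt i j hj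

/-- The functional counterfactual `F(u)`: the potential response of each variable under every
intervention on the set `Pa i`. -/
noncomputable def fctf (M : SCM n D) (Pa : Fin n → Finset (Fin n)) (u : M.U) (i : Fin n)
    (pa : ∀ j ∈ Pa i, D j) : D i :=
  M.resp (Pa i) pa u i

theorem resp_of_mem (M : SCM n D) {X : Finset (Fin n)} (x : ∀ i ∈ X, D i) (u : M.U) {i : Fin n}
    (h : i ∈ X) : M.resp X x u i = x i h := by
  rw [resp, dif_pos h]

theorem resp_of_notMem (M : SCM n D) {X : Finset (Fin n)} (x : ∀ i ∈ X, D i) (u : M.U)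
    {i : Fin n} (h : i ∉ X) :
    M.resp X x u i = M.mech i (fun j _ => M.resp X x u j) u := by
  rw [resp, dif_neg h]

theorem fctf_eq_mech (M : SCM n D) (u : M.U) (i : Fin n) (pa : ∀ j ∈ M.Pa i, D j) :
    M.fctf M.Pa u i pa = M.mech i pa u := by
  rw [fctf, resp_of_notMem M pa u fun h => lt_irrefl i (M.Pa_lt i i h)]
  congr 1
  funext j hj
  exact M.resp_of_mem pa u hj

theorem resp_eq_solve (M : SCM n D) {Pa : Fin n → Finset (Fin n)} (hPa : Pa = M.Pa)
    (hlt : ∀ i, ∀ j ∈ Pa i, j < i) (X : Finset (Fin n)) (x : ∀ i ∈ X, D i) (u : M.U)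
    (i : Fin n) : M.resp X x u i = solve Pa hlt (M.fctf Pa u) X x i := by
  subst hPa
  induction i using WellFoundedLT.induction with
  | ind i ih =>
    rw [solve]
    split_ifs with h
    · exact M.resp_of_mem x u h
    · rw [M.resp_of_notMem x u h, fctf_eq_mech]
      congr 1
      funext j hj
      exact ih j (M.Pa_lt i j hj)

/-- The query stating the joint event `F = f`. -/
noncomputable def fctfQuery [∀ i, Fintype (D i)] (Pa : Fin n → Finset (Fin n))
    (f : ∀ i, (∀ j ∈ Pa i, D j) → D i) : CtfQuery n D :=
  let e := Finite.equivFin (Σ i, ∀ j ∈ Pa i, D j)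
  { k := Nat.card (Σ i, ∀ j ∈ Pa i, D j)
    Y := fun l => {(e.symm l).1}
    X := fun l => Pa (e.symm l).1
    x := fun l => (e.symm l).2
    y := fun l _ h => Finset.mem_singleton.1 h ▸ f (e.symm l).1 (e.symm l).2 }

theorem ctfProb_fctfQuery [∀ i, Fintype (D i)] (M : SCM n D) (Pa : Fin n → Finset (Fin n))
    (f : ∀ i, (∀ j ∈ Pa i, D j) → D i) :
    M.ctfProb (fctfQuery Pa f) =
      ∑ u, if ∀ i pa, M.resp (Pa i) pa u i = f i pa then M.P u else 0 := by
  refine Finset.sum_congr rfl fun u _ => if_congr ⟨fun h i pa => ?_, fun h l i hi => ?_⟩ rfl rfl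
  · obtain ⟨l, hl⟩ := (Finite.equivFin (Σ i, ∀ j ∈ Pa i, D j)).symm.surjective ⟨i, pa⟩
    have key := h l ((Finite.equivFin (Σ i, ∀ j ∈ Pa i, D j)).symm l).1
      (Finset.mem_singleton_self _)
    simp only [fctfQuery] at key
    rwa [hl] at key
  · obtain rfl := Finset.mem_singleton.1 hi
    exact h _ _

/-- Every counterfactual probability is a sum of probabilities of events `F = f`. -/
theorem ctfProb_eq_sum (M : SCM n D) {Pa : Fin n → Finset (Fin n)} (hPa : Pa = M.Pa)
    (hlt : ∀ i, ∀ j ∈ Pa i, j < i) [Fintype (∀ i, (∀ j ∈ Pa i, D j) → D i)]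
    (q : CtfQuery n D) :
    M.ctfProb q = ∑ f : ∀ i, (∀ j ∈ Pa i, D j) → D i,
      if ∀ (l : Fin q.k) (i : Fin n) (h : i ∈ q.Y l),
          solve Pa hlt f (q.X l) (q.x l) i = q.y l i h
      then ∑ u, if ∀ i pa, M.resp (Pa i) pa u i = f i pa then M.P u else 0
      else 0 := by
  have hF : ∀ u f, (∀ i pa, M.resp (Pa i) pa u i = f i pa) ↔ M.fctf Pa u = f := fun u f =>
    ⟨fun h => funext fun i => funext fun pa => h i pa, fun h i pa => h ▸ rfl⟩
  simp only [hF]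
  calc
    M.ctfProb q = ∑ u, ∑ f : ∀ i, (∀ j ∈ Pa i, D j) → D i, if M.fctf Pa u = f then
        if ∀ (l : Fin q.k) (i : Fin n) (h : i ∈ q.Y l),
          solve Pa hlt f (q.X l) (q.x l) i = q.y l i h then M.P u else 0 else 0 := by
      simp only [ctfProb, M.resp_eq_solve hPa hlt, Finset.sum_ite_eq, Finset.mem_univ, if_true]
    _ = _ := by
      rw [Finset.sum_comm]
      refine Finset.sum_congr rfl fun f _ => ?_
      split_ifs <;> simp

end SCM

/-- **Functional counterfactual completeness.**
Let `M`, `M'` be finite recursive SCMs over the same variables, domains and parent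
sets.  Then `M` and `M'` assign the same probability to every joint
functional-counterfactual event `F = f` if and only if `L3(M) = L3(M')`. -/
theorem fctf_completeness {n : ℕ} {D : Fin n → Type u}
    [∀ i, Fintype (D i)] [∀ i, Nonempty (D i)]
    (M M' : SCM n D) (hPa : M.Pa = M'.Pa) :
    (∀ f : ∀ i : Fin n, (∀ j ∈ M.Pa i, D j) → D i,
        M.fctfProb f
          = ∑ u : M'.U,
              if ∀ (i : Fin n) (pa : ∀ j ∈ M.Pa i, D j),
                  M'.resp (M.Pa i) pa u i = f i pa
              then M'.P u else 0)
      ↔ L3eq M M' := by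
  constructor
  · intro h q
    have : Fintype (∀ i, (∀ j ∈ M.Pa i, D j) → D i) := Fintype.ofFinite _
    rw [M.ctfProb_eq_sum rfl M.Pa_lt, M'.ctfProb_eq_sum hPa M.Pa_lt]
    exact Finset.sum_congr rfl fun f _ => if_congr Iff.rfl (by convert h f; rw [SCM.fctfProb]) rfl
  · intro h f
    have key := h (SCM.fctfQuery M.Pa f)
    rw [M.ctfProb_fctfQuery, M'.ctfProb_fctfQuery] at key
    convert key
    rw [SCM.fctfProb]
    congr!
end

section
/- Front-door adjustment: let U_XY, U_X, U_Z, U_Y be finite independent random variables (with a product probability mass function), let X = f_X(U_XY, U_X), Z = f_Z(X, U_Z), and Y = f_Y(Z, U_XY, U_Y) for measurable maps into finite domains, and let Y_[X=x] := f_Y(f_Z(x, U_Z), U_XY, U_Y) denote the potential response of Y under the intervention X ← x. Suppose P(X = x) > 0 and P(X = x', Z = z) > 0 for every x' with P(X = x') > 0 and every z with P(Z = z, X = x) > 0. Then for every y: P(Y_[X=x] = y) = Σ_z P(Z = z | X = x) · Σ_{x'} P(Y = y | X = x', Z = z) · P(X = x'), where the sums range over z with P(Z = z | X = x) > 0 and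 x' with P(X = x') > 0. -/
set_option linter.unusedVariables false

open Classical

/-- The probability of the event `E` under the mass function `μ` on the finite
sample space `Ω`. -/
noncomputable def PrI {Ω : Type*} [Fintype Ω] (μ : Ω → ℝ) (E : Ω → Prop) : ℝ :=
  ∑ ω : Ω, if E ω then μ ω else 0

section PrI

variable {Ω : Type*} [Fintype Ω] {μ : Ω → ℝ}

theorem PrI_nonneg (hμ : ∀ ω, 0 ≤ μ ω) (E : Ω → Prop) : 0 ≤ PrI μ E :=
  Finset.sum_nonneg fun ω _ => by split_ifs <;> simp [hμ ω]

theorem PrI_true : PrI μ (fun _ => True) = ∑ ω, μ ω := by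
  simp [PrI]

theorem PrI_le_sum (hμ : ∀ ω, 0 ≤ μ ω) (E : Ω → Prop) : PrI μ E ≤ ∑ ω, μ ω :=
  Finset.sum_le_sum fun ω _ => by split_ifs <;> simp [hμ ω]

theorem PrI_congr {E F : Ω → Prop} (h : ∀ ω, E ω ↔ F ω) : PrI μ E = PrI μ F := by
  rw [show E = F from funext fun ω => propext (h ω)]

/-- The law of total probability over the fibres of `f`. -/
theorem sum_PrI_and_eq {α : Type*} [Fintype α] (E : Ω → Prop) (f : Ω → α) :
    ∑ a, PrI μ (fun ω => f ω = a ∧ E ω) = PrI μ E := by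
  simp only [PrI]
  rw [Finset.sum_comm]
  refine Finset.sum_congr rfl fun ω _ => ?_
  by_cases h : E ω <;> simp [h]

theorem sum_PrI_eq {α : Type*} [Fintype α] (f : Ω → α) :
    ∑ a, PrI μ (fun ω => f ω = a) = ∑ ω, μ ω := by
  simpa [PrI_true] using sum_PrI_and_eq (μ := μ) (fun _ => True) f

end PrI

/-- Factorisation of an event that is a conjunction of a condition on `(u_XY, u_X)`, a condition on
`u_Z` and a condition on `(u_XY, u_Y)`. -/
theorem PrI_product {UXY UX UZ UY : Type*}
    [Fintype UXY] [Fintype UX] [Fintype UZ] [Fintype UY]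
    {pXY : UXY → ℝ} {pX : UX → ℝ} {pZ : UZ → ℝ} {pY : UY → ℝ}
    {μ : UXY × UX × UZ × UY → ℝ}
    (hμ : ∀ ω, μ ω = pXY ω.1 * pX ω.2.1 * pZ ω.2.2.1 * pY ω.2.2.2)
    (E : UXY → UX → Prop) (F : UZ → Prop) (G : UXY → UY → Prop) :
    PrI μ (fun ω => E ω.1 ω.2.1 ∧ F ω.2.2.1 ∧ G ω.1 ω.2.2.2)
      = PrI pZ F * ∑ u, pXY u * PrI pX (E u) * PrI pY (G u) := by
  simp only [PrI, Fintype.sum_prod_type, hμ]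
  rw [Finset.mul_sum]
  refine Finset.sum_congr rfl fun u _ => ?_
  rw [mul_comm (pXY u), mul_assoc, mul_left_comm, Finset.sum_mul]
  refine Finset.sum_congr rfl fun v _ => ?_
  rw [mul_left_comm, Finset.sum_mul, Finset.mul_sum]
  refine Finset.sum_congr rfl fun w _ => ?_
  simp only [Finset.mul_sum]
  refine Finset.sum_congr rfl fun t _ => ?_
  split_ifs <;> grind

/-- **Front-door adjustment.**
Independent finite exogenous variables `U_XY, U_X, U_Z, U_Y` with product mass
function `μ`; mechanisms `X = fX(u_XY, u_X)`, `Z = fZ(X, u_Z)`,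
`Y = fY(Z, u_XY, u_Y)`; `Yint x` is the potential response of `Y` under the
intervention `X ← x`.  Suppose `P(X = x) > 0`, and `P(X = x', Z = z) > 0` for every
`x'` with `P(X = x') > 0` and every `z` with `P(Z = z, X = x) > 0`.  Then
`P(Y_[X=x] = y) = Σ_z P(Z = z | X = x) · Σ_{x'} P(Y = y | X = x', Z = z) · P(X = x')`,
the sums ranging over `z` with `P(Z = z | X = x) > 0` and `x'` with `P(X = x') > 0`. -/
theorem frontdoor_adjustment
    {UXY UX UZ UY ΩX ΩZ ΩY : Type*}
    [Fintype UXY] [Fintype UX] [Fintype UZ] [Fintype UY]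
    [Fintype ΩX] [Fintype ΩZ] [Fintype ΩY]
    (pXY : UXY → ℝ) (pX : UX → ℝ) (pZ : UZ → ℝ) (pY : UY → ℝ)
    (hXY0 : ∀ u, 0 ≤ pXY u) (hX0 : ∀ u, 0 ≤ pX u) (hZ0 : ∀ u, 0 ≤ pZ u)
    (hY0 : ∀ u, 0 ≤ pY u)
    (hXY1 : ∑ u : UXY, pXY u = 1) (hX1 : ∑ u : UX, pX u = 1)
    (hZ1 : ∑ u : UZ, pZ u = 1) (hY1 : ∑ u : UY, pY u = 1)
    (fX : UXY → UX → ΩX) (fZ : ΩX → UZ → ΩZ) (fY : ΩZ → UXY → UY → ΩY)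
    (μ : UXY × UX × UZ × UY → ℝ)
    (hμ : ∀ ω, μ ω = pXY ω.1 * pX ω.2.1 * pZ ω.2.2.1 * pY ω.2.2.2)
    (X : UXY × UX × UZ × UY → ΩX) (hX : ∀ ω, X ω = fX ω.1 ω.2.1)
    (Z : UXY × UX × UZ × UY → ΩZ) (hZ : ∀ ω, Z ω = fZ (X ω) ω.2.2.1)
    (Y : UXY × UX × UZ × UY → ΩY) (hY : ∀ ω, Y ω = fY (Z ω) ω.1 ω.2.2.2)
    (Yint : ΩX → UXY × UX × UZ × UY → ΩY)
    (hYint : ∀ x ω, Yint x ω = fY (fZ x ω.2.2.1) ω.1 ω.2.2.2)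
    (x : ΩX) (y : ΩY)
    (hx : 0 < PrI μ (fun ω => X ω = x))
    (hpos : ∀ x' : ΩX, 0 < PrI μ (fun ω => X ω = x') →
      ∀ z : ΩZ, 0 < PrI μ (fun ω => Z ω = z ∧ X ω = x) →
        0 < PrI μ (fun ω => X ω = x' ∧ Z ω = z)) :
    PrI μ (fun ω => Yint x ω = y)
      = ∑ z ∈ Finset.univ.filter
            (fun z : ΩZ =>
              0 < PrI μ (fun ω => Z ω = z ∧ X ω = x) / PrI μ (fun ω => X ω = x)),
          (PrI μ (fun ω => Z ω = z ∧ X ω = x) / PrI μ (fun ω => X ω = x))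
            * ∑ x' ∈ Finset.univ.filter
                  (fun x' : ΩX => 0 < PrI μ (fun ω => X ω = x')),
                PrI μ (fun ω => Y ω = y ∧ X ω = x' ∧ Z ω = z)
                    / PrI μ (fun ω => X ω = x' ∧ Z ω = z)
                  * PrI μ (fun ω => X ω = x') := by
  have hPX : ∀ x', PrI μ (fun ω => X ω = x') = ∑ u, pXY u * PrI pX (fun v => fX u v = x') := by
    intro x'
    have h := PrI_product hμ (fun u v => fX u v = x') (fun _ => True) (fun _ _ => True)
    simp only [PrI_true, hZ1, hY1, one_mul, mul_one] at h
    rw [← h]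
    exact PrI_congr fun ω => by simp [hX]
  have hPXZ : ∀ x' z, PrI μ (fun ω => X ω = x' ∧ Z ω = z)
      = PrI pZ (fun w => fZ x' w = z) * PrI μ (fun ω => X ω = x') := by
    intro x' z
    have h := PrI_product hμ (fun u v => fX u v = x') (fun w => fZ x' w = z) (fun _ _ => True)
    simp only [PrI_true, hY1, mul_one] at h
    rw [hPX, ← h]
    refine PrI_congr fun ω => ?_
    rw [hZ, ← hX]
    grind
  have hPYXZ : ∀ x' z, PrI μ (fun ω => Y ω = y ∧ X ω = x' ∧ Z ω = z)
      = PrI pZ (fun w => fZ x' w = z)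
        * ∑ u, pXY u * PrI pX (fun v => fX u v = x') * PrI pY (fun t => fY z u t = y) := by
    intro x' z
    rw [← PrI_product hμ (fun u v => fX u v = x') (fun w => fZ x' w = z) (fun u t => fY z u t = y)]
    refine PrI_congr fun ω => ?_
    rw [hY, hZ, ← hX]
    grind
  have hPZX : ∀ z, PrI μ (fun ω => Z ω = z ∧ X ω = x) / PrI μ (fun ω => X ω = x)
      = PrI pZ (fun w => fZ x w = z) := by
    intro z
    rw [PrI_congr fun ω => and_comm, hPXZ, mul_div_cancel_right₀ _ hx.ne']
  have hint : PrI μ (fun ω => Yint x ω = y) = ∑ z, PrI pZ (fun w => fZ x w = z)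
      * ∑ u, pXY u * PrI pY (fun t => fY z u t = y) := by
    rw [← sum_PrI_and_eq _ (fun ω => fZ x ω.2.2.1)]
    refine Finset.sum_congr rfl fun z _ => ?_
    have h := PrI_product hμ (fun _ _ => True) (fun w => fZ x w = z) (fun u t => fY z u t = y)
    simp only [PrI_true, hX1, mul_one] at h
    rw [← h]
    exact PrI_congr fun ω => by rw [hYint]; grind
  have hnull : ∀ x' z, ¬ 0 < PrI μ (fun ω => X ω = x') →
      ∑ u, pXY u * PrI pX (fun v => fX u v = x') * PrI pY (fun t => fY z u t = y) = 0 := by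
    intro x' z h
    rw [hPX] at h
    have hn : ∀ u, 0 ≤ pXY u * PrI pX (fun v => fX u v = x') := fun u =>
      mul_nonneg (hXY0 u) (PrI_nonneg hX0 _)
    refine le_antisymm (le_trans (Finset.sum_le_sum fun u _ => ?_) (not_lt.1 h))
      (Finset.sum_nonneg fun u _ => mul_nonneg (hn u) (PrI_nonneg hY0 _))
    exact mul_le_of_le_one_right (hn u) (hY1 ▸ PrI_le_sum hY0 _)
  simp only [hPZX]
  rw [hint, Finset.sum_filter_of_ne fun z _ h =>
    (PrI_nonneg hZ0 _).lt_of_ne' (left_ne_zero_of_mul h)]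
  refine Finset.sum_congr rfl fun z _ => ?_
  rcases (PrI_nonneg hZ0 fun w => fZ x w = z).eq_or_lt with hz | hz
  · rw [← hz, zero_mul, zero_mul]
  congr 1
  have hzx : 0 < PrI μ (fun ω => Z ω = z ∧ X ω = x) := by
    rw [PrI_congr fun ω => and_comm, hPXZ]
    exact mul_pos hz hx
  calc ∑ u, pXY u * PrI pY (fun t => fY z u t = y)
      = ∑ x', ∑ u, pXY u * PrI pX (fun v => fX u v = x') * PrI pY (fun t => fY z u t = y) := by
        rw [Finset.sum_comm]
        simp only [← Finset.sum_mul, ← Finset.mul_sum, sum_PrI_eq, hX1, mul_one]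
    _ = ∑ x' ∈ Finset.univ.filter (fun x' : ΩX => 0 < PrI μ (fun ω => X ω = x')),
          ∑ u, pXY u * PrI pX (fun v => fX u v = x') * PrI pY (fun t => fY z u t = y) :=
        (Finset.sum_filter_of_ne fun x' _ h => not_not.1 fun h' => h (hnull x' z h')).symm
    _ = _ := by
        refine Finset.sum_congr rfl fun x' hx' => ?_
        have hx'pos := (Finset.mem_filter.1 hx').2
        have hxz := hpos x' hx'pos z hzx
        rw [hPXZ] at hxz
        have hb := left_ne_zero_of_mul hxz.ne'
        rw [hPYXZ, hPXZ, mul_div_mul_left _ _ hb, div_mul_cancel₀ _ hx'pos.ne']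
end

section
/- Let τ be the constructive abstraction function determined by an admissible intervariable clustering ℂ and intravariable clustering 𝔻, let M_L be a finite recursive SCM over V_L satisfying the abstract invariance condition with respect to τ, and let ψ_τ(M_L) be any finite recursive SCM over V_H that is L3-τ consistent with M_L. Say that Layer j τ-collapses to Layer i (for i < j, with layers 1, 2, 3 defined below) relative to M_L if every finite recursive SCM M_H over V_H that is L_i-τ consistent with M_L is also L_j-τ consistent with M_L; say that Layer j collapses to Layer i relative to an SCM M* over V_H if every finite recursive SCM M over V_H with L_i(M) = L_i(M*) also satisfies L_j(M) = L_j(M*). Then Layer j τ-collapses to Layer i relative to M_L if and only if Layer j collapses to Layer i relative to ψ_τ(M_L). -/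
set_option linter.unusedVariables false

open Classical

universe u

/-- An intervariable clustering: a partition `C 0, …, C (m-1)` of a subset of the
low-level variables `Fin n` into nonempty, pairwise disjoint clusters, listed in
order. -/
structure InterClustering (n : ℕ) where
  m : ℕ
  C : Fin m → Finset (Fin n)
  nonempty : ∀ i, (C i).Nonempty
  disj : ∀ i j : Fin m, i ≠ j → Disjoint (C i) (C j)

/-- Admissibility of an intervariable clustering with respect to an SCM: in the given
ordering of the clusters, every endogenous parent of a variable in a cluster lies in
the same cluster or an earlier one. -/
def InterClustering.AdmissibleFor {n : ℕ} {D : Fin n → Type u}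
    (cl : InterClustering n) (M : SCM n D) : Prop :=
  ∀ i : Fin cl.m, ∀ v ∈ cl.C i, ∀ p ∈ M.Pa v, ∃ i' : Fin cl.m, i' ≤ i ∧ p ∈ cl.C i'

/-- Admissibility of the clustering itself: the given ordering of the clusters is
compatible with the (topological) ordering of the low-level variables, so that in
any SCM a variable of an earlier cluster may serve as a parent of a variable of a
later cluster. -/
def InterClustering.OrderedAdmissible {n : ℕ} (cl : InterClustering n) : Prop :=
  ∀ a b : Fin cl.m, a < b → ∀ v ∈ cl.C a, ∀ w ∈ cl.C b, v < w

/-- An intravariable clustering relative to the intervariable clustering `cl`: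
for each cluster `i`, a partition of the joint domain `D_{C i}` of the cluster into
nonempty blocks, presented as a surjection `tc i` onto the (finite) set of blocks
`B i`; `B i` is the domain of the `i`-th high-level variable, and `tc i c` is the
unique block containing `c`. -/
structure IntraClustering {n : ℕ} (D : Fin n → Type u) (cl : InterClustering n) where
  B : Fin cl.m → Type u
  fintypeB : ∀ i, Fintype (B i)
  tc : ∀ i : Fin cl.m, (∀ j ∈ cl.C i, D j) → B i
  tc_surj : ∀ i, Function.Surjective (tc i)

attribute [instance] IntraClustering.fintypeB

namespace IntraClustering

variable {n : ℕ} {D : Fin n → Type u} {cl : InterClustering n}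

/-- The constructive abstraction function `τ` determined by the clusterings, on full
low-level assignments. -/
def tau (intra : IntraClustering D cl) (v : ∀ i : Fin n, D i) :
    ∀ i : Fin cl.m, intra.B i :=
  fun i => intra.tc i (fun j _ => v j)

/-- `τ` applied to a value of a union of clusters (`S` is the set of cluster indices,
the union of clusters being `S.biUnion cl.C`). -/
def tauOn (intra : IntraClustering D cl) (S : Finset (Fin cl.m))
    (x : ∀ v ∈ S.biUnion cl.C, D v) : ∀ i ∈ S, intra.B i :=
  fun i hi => intra.tc i (fun j hj => x j (Finset.mem_biUnion.mpr ⟨i, hi, hj⟩))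

end IntraClustering

/-- A low-level counterfactual query whose term sets and intervened sets are unions of
clusters, together with a high-level outcome.  `Ys j` and `Xs j` are the sets of
cluster indices of the `j`-th term, `x j` is the low-level intervention value on the
union of the clusters of `Xs j`, and `yH j` is the high-level outcome of the term. -/
structure AbsQuery {n : ℕ} (D : Fin n → Type u) (cl : InterClustering n)
    (intra : IntraClustering D cl) where
  k : ℕ
  Ys : Fin k → Finset (Fin cl.m)
  Xs : Fin k → Finset (Fin cl.m)
  x  : ∀ j : Fin k, ∀ v ∈ (Xs j).biUnion cl.C, D v
  yH : ∀ j : Fin k, ∀ i ∈ Ys j, intra.B i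

section Values

variable {n : ℕ} {D : Fin n → Type u} {cl : InterClustering n}

/-- The value of the low-level query `Q` under the low-level SCM `M`: the sum, over
all low-level outcome values `y_{L,*}` mapping to the high-level outcome `y_{H,*}`
under `τ`, of the counterfactual probability
`P^M(Y_{L,1[x_{L,1}]} = y_{L,1}, …, Y_{L,k[x_{L,k}]} = y_{L,k})`. -/
noncomputable def lowValue [∀ i, Fintype (D i)] (M : SCM n D)
    (intra : IntraClustering D cl) (q : AbsQuery D cl intra) : ℝ :=
  ∑ yL : ∀ j : Fin q.k, ∀ v ∈ (q.Ys j).biUnion cl.C, D v,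
    if ∀ (j : Fin q.k) (i : Fin cl.m) (hi : i ∈ q.Ys j),
        intra.tauOn (q.Ys j) (yL j) i hi = q.yH j i hi
    then M.ctfProb ⟨q.k, fun j => (q.Ys j).biUnion cl.C,
        fun j => (q.Xs j).biUnion cl.C, q.x, yL⟩
    else 0

/-- The value of the high-level counterpart `τ(Q)` under a high-level SCM `MH`:
`P^{MH}(τ(Y_{L,1})_{[τ(x_{L,1})]} = y_{H,1}, …)`. -/
noncomputable def highValue (intra : IntraClustering D cl)
    (MH : SCM cl.m intra.B) (q : AbsQuery D cl intra) : ℝ :=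
  MH.ctfProb ⟨q.k, q.Ys, q.Xs, fun j => intra.tauOn (q.Xs j) (q.x j), q.yH⟩

/-- `MH` is `Q`-`τ` consistent with `ML`: the value of `Q` induced by `ML` equals the
value of `τ(Q)` induced by `MH`. -/
def QTauConsistent [∀ i, Fintype (D i)] (ML : SCM n D)
    (intra : IntraClustering D cl) (MH : SCM cl.m intra.B)
    (q : AbsQuery D cl intra) : Prop :=
  lowValue ML intra q = highValue intra MH q

/-- `MH` is `L3`-`τ` consistent with `ML`: `Q`-`τ` consistency holds for every query. -/
def L3TauConsistent [∀ i, Fintype (D i)] (ML : SCM n D)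
    (intra : IntraClustering D cl) (MH : SCM cl.m intra.B) : Prop :=
  ∀ q : AbsQuery D cl intra, QTauConsistent ML intra MH q

/-- The abstract invariance condition (AIC): whenever two full low-level assignments
`v1, v2` map to the same high-level value under `τ`, then for every exogenous value
`u` and every cluster `i`, the tuple of mechanism outputs of the cluster's variables
on the `v1`-parent values and on the `v2`-parent values lie in the same block. -/
def AIC (ML : SCM n D) (intra : IntraClustering D cl) : Prop :=
  ∀ v1 v2 : ∀ i : Fin n, D i, intra.tau v1 = intra.tau v2 →
    ∀ u : ML.U, ∀ i : Fin cl.m,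
      intra.tc i (fun j _ => ML.mech j (fun p _ => v1 p) u)
        = intra.tc i (fun j _ => ML.mech j (fun p _ => v2 p) u)

end Values

/-- Membership of a counterfactual query in Layer `ℓ` of the causal hierarchy:
Layer 3 contains all queries, Layer 2 the single-term ones, Layer 1 the single-term
ones with empty intervention. -/
def CtfQuery.InLayer {n : ℕ} {D : Fin n → Type u} (ℓ : ℕ) (q : CtfQuery n D) : Prop :=
  (ℓ = 1 → q.k = 1 ∧ ∀ j, q.X j = ∅) ∧ (ℓ = 2 → q.k = 1)

/-- `L_ℓ(M) = L_ℓ(M')`: equal probability on every Layer-`ℓ` query. -/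
def LayerEq {n : ℕ} {D : Fin n → Type u} (ℓ : ℕ) (M M' : SCM n D) : Prop :=
  ∀ q : CtfQuery n D, q.InLayer ℓ → M.ctfProb q = M'.ctfProb q

/-- Membership of an abstract query in Layer `ℓ`. -/
def AbsQuery.InLayer {n : ℕ} {D : Fin n → Type u} {cl : InterClustering n}
    {intra : IntraClustering D cl} (ℓ : ℕ) (q : AbsQuery D cl intra) : Prop :=
  (ℓ = 1 → q.k = 1 ∧ ∀ j, q.Xs j = ∅) ∧ (ℓ = 2 → q.k = 1)

/-- `MH` is `L_ℓ`-`τ` consistent with `ML`: `Q`-`τ` consistency for every Layer-`ℓ`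
query. -/
def LayerTauConsistent {n : ℕ} {D : Fin n → Type u} [∀ i, Fintype (D i)]
    {cl : InterClustering n} (ℓ : ℕ) (ML : SCM n D)
    (intra : IntraClustering D cl) (MH : SCM cl.m intra.B) : Prop :=
  ∀ q : AbsQuery D cl intra, q.InLayer ℓ → QTauConsistent ML intra MH q

/-- `τ` on unions of clusters is surjective: values of the individual clusters can be
glued because the clusters are disjoint. -/
theorem IntraClustering.tauOn_surjective {n : ℕ} {D : Fin n → Type u}
    {cl : InterClustering n} (intra : IntraClustering D cl) (S : Finset (Fin cl.m)) :
    Function.Surjective (intra.tauOn S) := by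
  intro b
  have hex : ∀ v ∈ S.biUnion cl.C, ∃ i, ∃ _ : i ∈ S, v ∈ cl.C i := fun v hv => by
    simpa using hv
  choose idx hidx hmem using hex
  choose c hc using fun (i : Fin cl.m) (hi : i ∈ S) => intra.tc_surj i (b i hi)
  refine ⟨fun v hv => c (idx v hv) (hidx v hv) v (hmem v hv), ?_⟩
  funext i hi
  rw [← hc i hi]
  refine congrArg (intra.tc i) (funext fun v => funext fun hv => ?_)
  have key : ∀ (i' : Fin cl.m) (hi' : i' ∈ S) (hv' : v ∈ cl.C i'),
      c i' hi' v hv' = c i hi v hv := by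
    intro i' hi' hv'
    obtain rfl : i' = i := by
      by_contra hne
      exact Finset.disjoint_left.mp (cl.disj i' i hne) hv' hv
    rfl
  exact key _ _ _

/-- Given one `L3`-`τ` consistent high-level SCM `ψ`, a high-level SCM is `L_ℓ`-`τ`
consistent exactly when it agrees with `ψ` on Layer `ℓ`. -/
theorem layerTauConsistent_iff_layerEq {n : ℕ} {D : Fin n → Type u}
    [∀ i, Fintype (D i)] {cl : InterClustering n} {intra : IntraClustering D cl}
    {ML : SCM n D} {ψ : SCM cl.m intra.B} (hψ : L3TauConsistent ML intra ψ)
    (ℓ : ℕ) (MH : SCM cl.m intra.B) :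
    LayerTauConsistent ℓ ML intra MH ↔ LayerEq ℓ MH ψ := by
  constructor
  · rintro h ⟨k, Y, X, x, y⟩ hq
    choose xL hxL using fun j => intra.tauOn_surjective (X j) (x j)
    obtain rfl : (fun j => intra.tauOn (X j) (xL j)) = x := funext hxL
    exact (h ⟨k, Y, X, xL, y⟩ hq).symm.trans (hψ ⟨k, Y, X, xL, y⟩)
  · intro h q hq
    exact (hψ q).trans (h ⟨q.k, q.Ys, q.Xs, _, q.yH⟩ hq).symm

/-- **Abstract causal hierarchy collapse.**
Let `τ` be the constructive abstraction function determined by an admissible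
intervariable clustering and an intravariable clustering, let `ML` satisfy the AIC
with respect to `τ`, and let `ψ` be a high-level SCM that is `L3`-`τ` consistent with
`ML`.  For `1 ≤ i < j ≤ 3`:  Layer `j` `τ`-collapses to Layer `i` relative to `ML`
(every high-level SCM that is `L_i`-`τ` consistent with `ML` is also `L_j`-`τ`
consistent) if and only if Layer `j` collapses to Layer `i` relative to `ψ`
(every high-level SCM agreeing with `ψ` on Layer `i` also agrees on Layer `j`). -/
theorem tau_collapse_iff_collapse {n : ℕ} {D : Fin n → Type u}
    [∀ i, Fintype (D i)] [∀ i, Nonempty (D i)]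
    (cl : InterClustering n) (intra : IntraClustering D cl)
    (ML : SCM n D) (hadm : cl.AdmissibleFor ML) (hAIC : AIC ML intra)
    (ψ : SCM cl.m intra.B) (hψ : L3TauConsistent ML intra ψ)
    (i j : ℕ) (h1 : 1 ≤ i) (hij : i < j) (h3 : j ≤ 3) :
    (∀ MH : SCM cl.m intra.B,
        LayerTauConsistent i ML intra MH → LayerTauConsistent j ML intra MH)
      ↔
    (∀ M : SCM cl.m intra.B, LayerEq i M ψ → LayerEq j M ψ) := by
  simp only [layerTauConsistent_iff_layerEq hψ]
end
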